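/- Let f be a smooth, strictly convex function defined for all (x₁,x₂) ∈ ℝ², and let a ≤ −3/4 be a real constant. If f satisfies the PDE ∑_{i,j=1}^{2} F^{ij} ∂²w/∂x_i∂x_j = 0 with w := [det(∂²f/∂x_i∂x_j)]^a on all of ℝ², then f is a quadratic polynomial. -/

import Mathlib

open Real Filter Topology Matrix

noncomputable section

/-- The `i`-th partial derivative of `f`. -/
def pd {n : ℕ} (i : Fin n) (f : (Fin n → ℝ) → ℝ) : (Fin n → ℝ) → ℝ :=
  fun x => fderiv ℝ f x (Pi.single i 1)

/-- The Hessian matrix `(∂²f/∂x_i∂x_j)` of `f` at `x`. -/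
def hess {n : ℕ} (f : (Fin n → ℝ) → ℝ) (x : Fin n → ℝ) : Matrix (Fin n) (Fin n) ℝ :=
  Matrix.of fun i j => pd i (pd j f) x

/-- The gradient vector of `f` at `x`. -/
def gradv {n : ℕ} (f : (Fin n → ℝ) → ℝ) (x : Fin n → ℝ) : Fin n → ℝ :=
  fun i => pd i f x

/-- `ρ := (det (f_ij))^(-1/(n+2))`. -/
def rho {n : ℕ} (f : (Fin n → ℝ) → ℝ) (x : Fin n → ℝ) : ℝ :=
  (hess f x).det ^ (-(1 : ℝ) / ((n : ℝ) + 2))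

/-- The squared norm `‖grad h‖² = ∑ f^{ij} h_i h_j` with respect to the Calabi metric of `f`. -/
def gradSq {n : ℕ} (f h : (Fin n → ℝ) → ℝ) (x : Fin n → ℝ) : ℝ :=
  ∑ i, ∑ j, (hess f x)⁻¹ i j * pd i h x * pd j h x

/-- The Laplacian `Δh = (1/√det)(∑ ∂_i(√det · f^{ij} ∂_j h))` with respect to the
Calabi metric of `f`. -/
def calabiLap {n : ℕ} (f h : (Fin n → ℝ) → ℝ) (x : Fin n → ℝ) : ℝ :=
  (Real.sqrt (hess f x).det)⁻¹ *
    ∑ i, ∑ j, pd i (fun y => Real.sqrt (hess f y).det * (hess f y)⁻¹ i j * pd j h y) x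

/-- `Φ := ‖grad ρ‖²/ρ²`. -/
def Phi {n : ℕ} (f : (Fin n → ℝ) → ℝ) (x : Fin n → ℝ) : ℝ :=
  gradSq f (rho f) x / (rho f x) ^ 2

/-- PDE (1.2): `Δρ = -β ‖grad ρ‖²/ρ` on `Ω`. -/
def PDE2 {n : ℕ} (f : (Fin n → ℝ) → ℝ) (β : ℝ) (Ω : Set (Fin n → ℝ)) : Prop :=
  ∀ x ∈ Ω, calabiLap f (rho f) x = -β * gradSq f (rho f) x / rho f x

/-- The cofactor matrix of a square matrix. -/
def cof {n : ℕ} (H : Matrix (Fin n) (Fin n) ℝ) : Matrix (Fin n) (Fin n) ℝ :=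
  (Matrix.adjugate H)ᵀ

/-- PDE (1.1): `∑ F^{ij} w_ij = 0` with `w = (det (f_ij))^a` on `Ω`, where `(F^{ij})`
is the cofactor matrix of the Hessian of `f`. -/
def PDE1 {n : ℕ} (f : (Fin n → ℝ) → ℝ) (a : ℝ) (Ω : Set (Fin n → ℝ)) : Prop :=
  ∀ x ∈ Ω, ∑ i, ∑ j,
    cof (hess f x) i j * pd i (pd j fun y => (hess f y).det ^ a) x = 0

/-- `f` is a quadratic polynomial on `ℝ²`. -/
def IsQuadratic (f : (Fin 2 → ℝ) → ℝ) : Prop :=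
  ∃ (Q : Matrix (Fin 2) (Fin 2) ℝ) (b : Fin 2 → ℝ) (c : ℝ),
    ∀ x, f x = (∑ i, ∑ j, Q i j * x i * x j) + (∑ i, b i * x i) + c

/-- Euclidean open ball of radius `r` centered at `0` in `ℝ²`. -/
def ebal (r : ℝ) : Set (Fin 2 → ℝ) := {x | (x 0) ^ 2 + (x 1) ^ 2 < r ^ 2}

/-- Euclidean norm on `ℝ²`. -/
def enorm2 (x : Fin 2 → ℝ) : ℝ := Real.sqrt ((x 0) ^ 2 + (x 1) ^ 2)

/-- A normalized convex domain: `B_{2^{-3/2}}(0) ⊆ Ω ⊆ B_1(0)`. -/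
def NormalizedDomain (Ω : Set (Fin 2 → ℝ)) : Prop :=
  IsOpen Ω ∧ Convex ℝ Ω ∧ ebal ((2 : ℝ) ^ (-(3 : ℝ) / 2)) ⊆ Ω ∧ Ω ⊆ ebal 1

/-- The class `𝒮(Ω,C)`: smooth strictly convex functions on `Ω` with `inf f = 0` and
`f = C` on `∂Ω`. -/
def SClass (Ω : Set (Fin 2 → ℝ)) (C : ℝ) (f : (Fin 2 → ℝ) → ℝ) : Prop :=
  ContDiffOn ℝ (⊤ : ℕ∞) f Ω ∧ (∀ x ∈ Ω, (hess f x).PosDef) ∧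
    sInf (f '' Ω) = 0 ∧ ContinuousOn f (closure Ω) ∧ ∀ x ∈ frontier Ω, f x = C

/-- `u` is the Legendre transform function of `f` relative to `0`:
`u(∇f(x)) = ⟨x, ∇f(x)⟩ - f(x)`. -/
def LegendreOf (Ω : Set (Fin 2 → ℝ)) (f u : (Fin 2 → ℝ) → ℝ) : Prop :=
  ∀ x ∈ Ω, u (gradv f x) = (∑ i, x i * gradv f x i) - f x

end

open MeasureTheory

/-! ### Partial derivatives -/

section PartialDerivatives

variable {n : ℕ} {u v : (Fin n → ℝ) → ℝ} {x : Fin n → ℝ}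

lemma pd_add (i : Fin n) (hu : DifferentiableAt ℝ u x) (hv : DifferentiableAt ℝ v x) :
    pd i (fun y => u y + v y) x = pd i u x + pd i v x := by
  simp [pd, fderiv_fun_add hu hv]

lemma pd_sub (i : Fin n) (hu : DifferentiableAt ℝ u x) (hv : DifferentiableAt ℝ v x) :
    pd i (fun y => u y - v y) x = pd i u x - pd i v x := by
  simp [pd, fderiv_fun_sub hu hv]

lemma pd_mul (i : Fin n) (hu : DifferentiableAt ℝ u x) (hv : DifferentiableAt ℝ v x) :
    pd i (fun y => u y * v y) x = u x * pd i v x + v x * pd i u x := by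
  simp [pd, fderiv_fun_mul hu hv]

lemma pd_const (i : Fin n) (c : ℝ) : pd i (fun _ => c) x = 0 := by
  simp [pd]

lemma pd_const_mul (i : Fin n) (c : ℝ) (hu : DifferentiableAt ℝ u x) :
    pd i (fun y => c * u y) x = c * pd i u x := by
  simp [pd, fderiv_const_mul hu]

lemma pd_comp (i : Fin n) {g : ℝ → ℝ} {g' : ℝ} (hg : HasDerivAt g g' (u x))
    (hu : DifferentiableAt ℝ u x) : pd i (fun y => g (u y)) x = g' * pd i u x := by
  have h := (hg.comp_hasFDerivAt x hu.hasFDerivAt).fderiv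
  simp only [Function.comp_def] at h
  simp [pd, h]

lemma pd_sq (i : Fin n) (hu : DifferentiableAt ℝ u x) :
    pd i (fun y => u y ^ 2) x = 2 * u x * pd i u x := by
  rw [pd_comp i (g := fun s => s ^ 2) (hasDerivAt_pow 2 (u x)) hu]
  simp

lemma pd_log (i : Fin n) (hu : DifferentiableAt ℝ u x) (h0 : u x ≠ 0) :
    pd i (fun y => log (u y)) x = pd i u x / u x := by
  rw [pd_comp i (Real.hasDerivAt_log h0) hu]
  ring

lemma pd_coord (i j : Fin n) : pd i (fun y => y j) x = if i = j then 1 else 0 := by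
  have h : fderiv ℝ (fun y : Fin n → ℝ => y j) x = ContinuousLinearMap.proj j :=
    (ContinuousLinearMap.proj (R := ℝ) (φ := fun _ : Fin n => ℝ) j).fderiv
  simp only [pd, h, ContinuousLinearMap.proj_apply, Pi.single_apply]
  simp [eq_comm]

lemma contDiff_pd (i : Fin n) (hu : ContDiff ℝ (⊤ : ℕ∞) u) : ContDiff ℝ (⊤ : ℕ∞) (pd i u) :=
  (hu.fderiv_right (m := (⊤ : ℕ∞)) (by simp)).clm_apply contDiff_const

lemma continuous_pd (i : Fin n) (hu : ContDiff ℝ 1 u) : Continuous (pd i u) :=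
  (hu.continuous_fderiv (by simp)).clm_apply continuous_const

lemma ContDiff.diffAt (hu : ContDiff ℝ (⊤ : ℕ∞) u) (x : Fin n → ℝ) : DifferentiableAt ℝ u x :=
  hu.differentiable (by simp) x

lemma pd_comm (i j : Fin n) (hu : ContDiff ℝ (⊤ : ℕ∞) u) : pd i (pd j u) = pd j (pd i u) := by
  have key : ∀ (k l : Fin n) (x), pd k (pd l u) x =
      fderiv ℝ (fderiv ℝ u) x (Pi.single k 1) (Pi.single l 1) := by
    intro k l x
    have hd : DifferentiableAt ℝ (fderiv ℝ u) x :=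
      (hu.fderiv_right (m := (⊤ : ℕ∞)) (by simp)).differentiable (by simp) x
    have h2 : pd l u = fun y => fderiv ℝ u y (Pi.single l 1) := rfl
    rw [h2, pd, fderiv_clm_apply hd (by fun_prop)]
    simp
  funext x
  rw [key, key]
  exact (hu.contDiffAt.isSymmSndFDerivAt (by simpa using (by exact_mod_cast le_top :
    ((2 : ℕ∞) : WithTop ℕ∞) ≤ ((⊤ : ℕ∞) : WithTop ℕ∞)))) _ _

lemma fderiv_eq_zero_of_pd_eq_zero (h : ∀ i, pd i u x = 0) : fderiv ℝ u x = 0 := by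
  ext w
  have hw : w = ∑ i, w i • (Pi.single i (1 : ℝ) : Fin n → ℝ) := by
    funext j
    simp [Finset.sum_apply, Pi.single_apply]
  rw [hw, map_sum]
  refine Finset.sum_eq_zero fun i _ => ?_
  have := h i
  simp only [pd] at this
  simp [this]

lemma eq_of_pd_eq_zero (hu : ContDiff ℝ (⊤ : ℕ∞) u) (h : ∀ x i, pd i u x = 0)
    (x y : Fin n → ℝ) : u x = u y :=
  is_const_of_fderiv_eq_zero (hu.differentiable (by simp))
    (fun z => fderiv_eq_zero_of_pd_eq_zero (h z)) x y

/-- Integration by parts on `ℝⁿ` against a compactly supported `C¹` function. -/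
lemma integral_mul_pd_add_pd_mul_eq_zero (i : Fin n) (hu : ContDiff ℝ 1 u)
    (hc : HasCompactSupport u) (hv : ContDiff ℝ 1 v) :
    Integrable (fun x => u x * pd i v x + pd i u x * v x) ∧
      ∫ x, (u x * pd i v x + pd i u x * v x) = 0 := by
  have hcu : HasCompactSupport (pd i u) := hc.fderiv_apply (𝕜 := ℝ) (Pi.single i 1)
  have h1 : Integrable fun x => pd i u x * v x :=
    ((continuous_pd i hu).mul hv.continuous).integrable_of_hasCompactSupport hcu.mul_right
  have h2 : Integrable fun x => u x * pd i v x :=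
    (hu.continuous.mul (continuous_pd i hv)).integrable_of_hasCompactSupport hc.mul_right
  have h3 : Integrable fun x => u x * v x :=
    (hu.continuous.mul hv.continuous).integrable_of_hasCompactSupport hc.mul_right
  refine ⟨h2.add h1, ?_⟩
  rw [integral_add h2 h1]
  have := integral_mul_fderiv_eq_neg_fderiv_mul_of_integrable (μ := volume) (f := u) (g := v)
    (v := Pi.single i 1) h1 h2 h3 (fun x _ => hu.differentiable (by simp) x)
    (fun x _ => hv.differentiable (by simp) x)
  simp only [pd]
  linarith

end PartialDerivatives

/-! ### The cofactor quadratic form of a positive definite `2 × 2` matrix -/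

section CofactorForm

/-- The bilinear form of the cofactor matrix of `!![r, s; s, t]`. -/
def cofForm (r s t u₀ u₁ v₀ v₁ : ℝ) : ℝ :=
  t * u₀ * v₀ - s * (u₀ * v₁ + u₁ * v₀) + r * u₁ * v₁

variable {r s t : ℝ}

lemma cofForm_self_nonneg (hr : 0 < r) (hd : 0 < r * t - s ^ 2) (u₀ u₁ : ℝ) :
    0 ≤ cofForm r s t u₀ u₁ u₀ u₁ := by
  have h : r * cofForm r s t u₀ u₁ u₀ u₁ =
      (r * t - s ^ 2) * u₀ ^ 2 + (s * u₀ - r * u₁) ^ 2 := by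
    unfold cofForm; ring
  have h2 : 0 ≤ r * cofForm r s t u₀ u₁ u₀ u₁ := by rw [h]; positivity
  exact nonneg_of_mul_nonneg_right h2 hr

lemma eq_zero_of_cofForm_self_eq_zero (hr : 0 < r) (hd : 0 < r * t - s ^ 2) {u₀ u₁ : ℝ}
    (h0 : cofForm r s t u₀ u₁ u₀ u₁ = 0) : u₀ = 0 ∧ u₁ = 0 := by
  have h : r * cofForm r s t u₀ u₁ u₀ u₁ =
      (r * t - s ^ 2) * u₀ ^ 2 + (s * u₀ - r * u₁) ^ 2 := by
    unfold cofForm; ring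
  rw [h0, mul_zero] at h
  have h1 : (r * t - s ^ 2) * u₀ ^ 2 = 0 := by
    have : 0 ≤ (r * t - s ^ 2) * u₀ ^ 2 := by positivity
    nlinarith [sq_nonneg (s * u₀ - r * u₁)]
  have hu : u₀ = 0 := by
    rcases mul_eq_zero.1 h1 with h2 | h2
    · exact absurd h2 hd.ne'
    · exact pow_eq_zero_iff (two_ne_zero) |>.1 h2
  refine ⟨hu, ?_⟩
  subst hu
  have : (r * u₁) ^ 2 = 0 := by nlinarith
  rcases mul_eq_zero.1 (pow_eq_zero_iff (two_ne_zero) |>.1 this) with h2 | h2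
  · exact absurd h2 hr.ne'
  · exact h2

lemma hessForm_nonneg (hr : 0 < r) (hd : 0 < r * t - s ^ 2) (u₀ u₁ : ℝ) :
    0 ≤ r * u₀ ^ 2 + 2 * s * u₀ * u₁ + t * u₁ ^ 2 := by
  have h : r * (r * u₀ ^ 2 + 2 * s * u₀ * u₁ + t * u₁ ^ 2) =
      (r * t - s ^ 2) * u₁ ^ 2 + (r * u₀ + s * u₁) ^ 2 := by ring
  have h2 : 0 ≤ r * (r * u₀ ^ 2 + 2 * s * u₀ * u₁ + t * u₁ ^ 2) := by rw [h]; positivity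
  exact nonneg_of_mul_nonneg_right h2 hr

lemma cofForm_self_le (hr : 0 < r) (hd : 0 < r * t - s ^ 2) (u₀ u₁ : ℝ) :
    cofForm r s t u₀ u₁ u₀ u₁ ≤ (r + t) * (u₀ ^ 2 + u₁ ^ 2) := by
  have := hessForm_nonneg hr hd u₀ u₁
  unfold cofForm
  linarith

lemma cofForm_hess_le (hr : 0 < r) (hd : 0 < r * t - s ^ 2) (p₀ p₁ : ℝ) :
    cofForm r s t (r * p₀ + s * p₁) (s * p₀ + t * p₁) (r * p₀ + s * p₁) (s * p₀ + t * p₁) ≤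
      (r * t - s ^ 2) * ((r + t) * (p₀ ^ 2 + p₁ ^ 2)) := by
  have h : cofForm r s t (r * p₀ + s * p₁) (s * p₀ + t * p₁) (r * p₀ + s * p₁)
      (s * p₀ + t * p₁) =
      (r * t - s ^ 2) * (r * p₀ ^ 2 + 2 * s * p₀ * p₁ + t * p₁ ^ 2) := by
    unfold cofForm; ring
  rw [h]
  have := cofForm_self_nonneg hr hd p₀ p₁
  unfold cofForm at this
  gcongr
  linarith

lemma cofForm_add_le (hr : 0 < r) (hd : 0 < r * t - s ^ 2) (u₀ u₁ v₀ v₁ : ℝ) :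
    cofForm r s t (u₀ + v₀) (u₁ + v₁) (u₀ + v₀) (u₁ + v₁) ≤
      2 * cofForm r s t u₀ u₁ u₀ u₁ + 2 * cofForm r s t v₀ v₁ v₀ v₁ := by
  have := cofForm_self_nonneg hr hd (u₀ - v₀) (u₁ - v₁)
  unfold cofForm at *
  linarith

/-- The bound `|x + D⁻¹ H p|² ≤ 2 tr(H) (|x|² + |p|² / D)` for the norm of the cofactor form. -/
lemma cofForm_gradient_le (hr : 0 < r) (hd : 0 < r * t - s ^ 2) (x₀ x₁ p₀ p₁ : ℝ) :
    cofForm r s t (x₀ + (r * p₀ + s * p₁) / (r * t - s ^ 2))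
        (x₁ + (s * p₀ + t * p₁) / (r * t - s ^ 2))
        (x₀ + (r * p₀ + s * p₁) / (r * t - s ^ 2))
        (x₁ + (s * p₀ + t * p₁) / (r * t - s ^ 2)) ≤
      2 * ((r + t) * (x₀ ^ 2 + x₁ ^ 2 + (p₀ ^ 2 + p₁ ^ 2) / (r * t - s ^ 2))) := by
  have h1 := cofForm_add_le hr hd x₀ x₁ ((r * p₀ + s * p₁) / (r * t - s ^ 2))
    ((s * p₀ + t * p₁) / (r * t - s ^ 2))
  have h2 := cofForm_self_le hr hd x₀ x₁
  have h3 := cofForm_hess_le hr hd p₀ p₁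
  have h4 : ∀ d u₀ u₁ : ℝ, cofForm r s t (u₀ / d) (u₁ / d) (u₀ / d) (u₁ / d) =
      cofForm r s t u₀ u₁ u₀ u₁ / d ^ 2 := by
    intro d u₀ u₁
    unfold cofForm; ring
  rw [h4] at h1
  have h5 : cofForm r s t (r * p₀ + s * p₁) (s * p₀ + t * p₁) (r * p₀ + s * p₁)
      (s * p₀ + t * p₁) / (r * t - s ^ 2) ^ 2 ≤
      (r + t) * ((p₀ ^ 2 + p₁ ^ 2) / (r * t - s ^ 2)) := by
    rw [div_le_iff₀ (by positivity)]
    calc _ ≤ _ := h3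
      _ = _ := by field_simp
  linarith

/-- The pointwise inequality behind the weighted energy estimate: `(l₀, l₁)` is the gradient of
the unknown, `c` the coefficient in its divergence equation, `k` the contribution of the weight
and `e` that of the determinant inside the exhaustion function `E`. -/
lemma energy_pointwise (hr : 0 < r) (hd : 0 < r * t - s ^ 2) {m η c k e E : ℝ}
    (hm : 0 < m) (hη : 0 ≤ η) (hE : 0 < E) (hck : 1 / 12 ≤ c - k) (he : 0 ≤ e)
    {l₀ l₁ v₀ v₁ : ℝ}
    (hv : cofForm r s t v₀ v₁ v₀ v₁ ≤ 2 * ((r + t) * E)) :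
    1 / 24 * (m * η ^ 2 * cofForm r s t l₀ l₁ l₀ l₁) - 192 * (m * (r + t) / E) ≤
      m * η ^ 2 * (c * cofForm r s t l₀ l₁ l₀ l₁) +
      (-(k * (m * η ^ 2)) * l₀ - 2 * m * η * ((2 * v₀ - e * l₀) / E)) * (t * l₀ - s * l₁) +
      (-(k * (m * η ^ 2)) * l₁ - 2 * m * η * ((2 * v₁ - e * l₁) / E)) * (r * l₁ - s * l₀) := by
  have hq := cofForm_self_nonneg hr hd l₀ l₁
  have hs := cofForm_self_nonneg hr hd (η * l₀ - 48 * v₀ / E) (η * l₁ - 48 * v₁ / E)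
  have e1 : cofForm r s t (η * l₀ - 48 * v₀ / E) (η * l₁ - 48 * v₁ / E)
      (η * l₀ - 48 * v₀ / E) (η * l₁ - 48 * v₁ / E) =
      η ^ 2 * cofForm r s t l₀ l₁ l₀ l₁ - 96 * (η * cofForm r s t v₀ v₁ l₀ l₁ / E)
        + 2304 * (cofForm r s t v₀ v₁ v₀ v₁ / E ^ 2) := by
    unfold cofForm; ring
  have e2 : m * η ^ 2 * (c * cofForm r s t l₀ l₁ l₀ l₁) +
      (-(k * (m * η ^ 2)) * l₀ - 2 * m * η * ((2 * v₀ - e * l₀) / E)) * (t * l₀ - s * l₁) +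
      (-(k * (m * η ^ 2)) * l₁ - 2 * m * η * ((2 * v₁ - e * l₁) / E)) * (r * l₁ - s * l₀) =
      m * ((c - k) * (η ^ 2 * cofForm r s t l₀ l₁ l₀ l₁)
        + 2 * (η * e * cofForm r s t l₀ l₁ l₀ l₁ / E)
        - 4 * (η * cofForm r s t v₀ v₁ l₀ l₁ / E)) := by
    unfold cofForm; ring
  have e3 : cofForm r s t v₀ v₁ v₀ v₁ / E ^ 2 ≤ 2 * ((r + t) / E) := by
    rw [div_le_iff₀ (by positivity)]
    calc _ ≤ _ := hv
      _ = _ := by field_simp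
  have e4 : 0 ≤ η * e * cofForm r s t l₀ l₁ l₀ l₁ / E := by positivity
  have e5 : 1 / 12 * (η ^ 2 * cofForm r s t l₀ l₁ l₀ l₁) ≤
      (c - k) * (η ^ 2 * cofForm r s t l₀ l₁ l₀ l₁) :=
    mul_le_mul_of_nonneg_right hck (by positivity)
  have e6 : 1 / 24 * (m * η ^ 2 * cofForm r s t l₀ l₁ l₀ l₁) - 192 * (m * (r + t) / E) =
      m * (1 / 24 * (η ^ 2 * cofForm r s t l₀ l₁ l₀ l₁) - 192 * ((r + t) / E)) := by ring
  rw [e2, e6]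
  refine mul_le_mul_of_nonneg_left ?_ hm.le
  rw [e1] at hs
  linarith

end CofactorForm

/-! ### The exhaustion function and the weighted cutoff -/

section Cutoff

lemma hasDerivAt_max_zero_sq (y : ℝ) :
    HasDerivAt (fun z : ℝ => (max 0 z) ^ 2) (2 * max 0 y) y := by
  rcases lt_trichotomy y 0 with h | h | h
  · have : (fun z : ℝ => (max 0 z) ^ 2) =ᶠ[𝓝 y] fun _ => 0 := by
      filter_upwards [Iio_mem_nhds h] with z hz
      simp [max_eq_left (le_of_lt (Set.mem_Iio.1 hz))]
    rw [max_eq_left h.le, mul_zero]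
    exact (hasDerivAt_const y (0 : ℝ)).congr_of_eventuallyEq this
  · subst h
    rw [max_self, mul_zero, hasDerivAt_iff_isLittleO_nhds_zero]
    have h1 : (fun z : ℝ => z ^ 2) =o[𝓝 0] fun z => z := by
      simpa using Asymptotics.isLittleO_pow_pow (𝕜 := ℝ) (m := 1) (n := 2) (by norm_num)
    refine Asymptotics.IsBigO.trans_isLittleO (Asymptotics.IsBigO.of_bound 1 ?_) h1
    refine Filter.Eventually.of_forall fun z => ?_
    have h2 : max 0 z ≤ |z| := max_le (abs_nonneg z) (le_abs_self z)
    have h3 : (max 0 z) ^ 2 ≤ |z| ^ 2 := pow_le_pow_left₀ (le_max_left _ _) h2 2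
    rw [sq_abs] at h3
    simpa using h3
  · have : (fun z : ℝ => (max 0 z) ^ 2) =ᶠ[𝓝 y] fun z => z ^ 2 := by
      filter_upwards [Ioi_mem_nhds h] with z hz
      simp [max_eq_right (le_of_lt (Set.mem_Ioi.1 hz))]
    rw [max_eq_right h.le]
    have h2 := hasDerivAt_pow 2 y
    norm_num at h2
    exact h2.congr_of_eventuallyEq this

lemma contDiff_max_zero_sq : ContDiff ℝ 1 fun z : ℝ => (max 0 z) ^ 2 := by
  rw [contDiff_one_iff_deriv]
  refine ⟨fun y => (hasDerivAt_max_zero_sq y).differentiableAt, ?_⟩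
  rw [show deriv (fun z : ℝ => (max 0 z) ^ 2) = fun y => 2 * max 0 y from
    funext fun y => (hasDerivAt_max_zero_sq y).deriv]
  fun_prop

/-- The determinant of the Hessian of a function of two variables. -/
noncomputable def hessDet (f : (Fin 2 → ℝ) → ℝ) (x : Fin 2 → ℝ) : ℝ :=
  pd 0 (pd 0 f) x * pd 1 (pd 1 f) x - pd 0 (pd 1 f) x ^ 2

/-- The exhaustion function `1 + |x|² + |∇f|² / det D²f`. -/
noncomputable def exhaustion (f : (Fin 2 → ℝ) → ℝ) (x : Fin 2 → ℝ) : ℝ :=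
  1 + (x 0 ^ 2 + x 1 ^ 2 + (pd 0 f x ^ 2 + pd 1 f x ^ 2) / hessDet f x)

/-- The weight `1 / (1 + (det D²f)^(2/3))`. -/
noncomputable def weight (f : (Fin 2 → ℝ) → ℝ) (x : Fin 2 → ℝ) : ℝ :=
  (1 + hessDet f x ^ (2 / 3 : ℝ))⁻¹

/-- The weighted cutoff, supported in the sublevel set `exhaustion f ≤ exp T`. -/
noncomputable def cutoff (f : (Fin 2 → ℝ) → ℝ) (T : ℝ) (x : Fin 2 → ℝ) : ℝ :=
  weight f x * (max 0 (T - log (exhaustion f x))) ^ 2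

variable {f : (Fin 2 → ℝ) → ℝ} (hf : ContDiff ℝ (⊤ : ℕ∞) f)

include hf in
lemma contDiff_hessDet : ContDiff ℝ (⊤ : ℕ∞) (hessDet f) :=
  ((contDiff_pd 0 (contDiff_pd 0 hf)).mul (contDiff_pd 1 (contDiff_pd 1 hf))).sub
    ((contDiff_pd 0 (contDiff_pd 1 hf)).pow 2)

variable (hD : ∀ x, 0 < hessDet f x)

include hD in
lemma normSq_le_exhaustion (x : Fin 2 → ℝ) : 1 + (x 0 ^ 2 + x 1 ^ 2) ≤ exhaustion f x := by
  have : 0 ≤ (pd 0 f x ^ 2 + pd 1 f x ^ 2) / hessDet f x :=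
    div_nonneg (by positivity) (hD x).le
  unfold exhaustion
  linarith

include hD in
lemma one_le_exhaustion (x : Fin 2 → ℝ) : 1 ≤ exhaustion f x := by
  have := normSq_le_exhaustion hD x
  nlinarith [sq_nonneg (x 0), sq_nonneg (x 1)]

include hD in
lemma weight_pos (x : Fin 2 → ℝ) : 0 < weight f x :=
  inv_pos.2 (by have := rpow_pos_of_pos (hD x) (2 / 3); linarith)

include hf hD in
lemma contDiff_exhaustion : ContDiff ℝ (⊤ : ℕ∞) (exhaustion f) := by
  have h0 := contDiff_pd 0 hf
  have h1 := contDiff_pd 1 hf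
  exact contDiff_const.add (((contDiff_apply ℝ ℝ 0).pow 2 |>.add
    ((contDiff_apply ℝ ℝ 1).pow 2)).add
    (((h0.pow 2).add (h1.pow 2)).div (contDiff_hessDet hf) fun x => (hD x).ne'))

include hf hD in
lemma contDiff_weight : ContDiff ℝ (⊤ : ℕ∞) (weight f) := by
  refine ContDiff.inv (contDiff_const.add
    ((contDiff_hessDet hf).rpow_const_of_ne fun x => (hD x).ne')) fun x => ?_
  have := rpow_pos_of_pos (hD x) (2 / 3)
  linarith

include hf hD in
lemma contDiff_log_exhaustion (T : ℝ) :
    ContDiff ℝ (⊤ : ℕ∞) fun x => T - log (exhaustion f x) :=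
  contDiff_const.sub ((contDiff_exhaustion hf hD).log fun x =>
    (zero_lt_one.trans_le (one_le_exhaustion hD x)).ne')

include hf hD in
lemma contDiff_cutoff (T : ℝ) : ContDiff ℝ 1 (cutoff f T) :=
  ((contDiff_weight hf hD).of_le (by exact_mod_cast le_top)).mul
    (contDiff_max_zero_sq.comp
      ((contDiff_log_exhaustion hf hD T).of_le (by exact_mod_cast le_top)))

include hf hD in
lemma pd_exhaustion (i : Fin 2) (x : Fin 2 → ℝ) :
    pd i (exhaustion f) x =
      2 * (x i + (pd i (pd 0 f) x * pd 0 f x + pd i (pd 1 f) x * pd 1 f x) / hessDet f x)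
        - (pd 0 f x ^ 2 + pd 1 f x ^ 2) / hessDet f x * (pd i (hessDet f) x / hessDet f x) := by
  have h0 := (contDiff_pd 0 hf).diffAt x
  have h1 := (contDiff_pd 1 hf).diffAt x
  have hd := (contDiff_hessDet hf).diffAt x
  have hx : ∀ j : Fin 2, DifferentiableAt ℝ (fun y : Fin 2 → ℝ => y j) x := fun j => by fun_prop
  have hne := (hD x).ne'
  unfold exhaustion
  simp only [div_eq_mul_inv]
  rw [pd_add i (by fun_prop) (by fun_prop), pd_add i (by fun_prop) (by fun_prop),
    pd_add i (by fun_prop) (by fun_prop), pd_mul i (by fun_prop) (by fun_prop),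
    pd_add i (by fun_prop) (by fun_prop), pd_const, pd_sq i (hx 0), pd_sq i (hx 1),
    pd_sq i h0, pd_sq i h1, pd_comp i (hasDerivAt_inv hne) hd, pd_coord, pd_coord]
  fin_cases i <;> simp <;> field_simp <;> ring

include hf hD in
lemma pd_weight (i : Fin 2) (x : Fin 2 → ℝ) :
    pd i (weight f) x =
      -(2 / 3 * (1 - weight f x) * weight f x * (pd i (hessDet f) x / hessDet f x)) := by
  have hd := (contDiff_hessDet hf).diffAt x
  have hpos := rpow_pos_of_pos (hD x) (2 / 3)
  have h1 : HasDerivAt (fun z : ℝ => (1 + z ^ (2 / 3 : ℝ))⁻¹)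
      (-(2 / 3 * hessDet f x ^ ((2 / 3 : ℝ) - 1)) / (1 + hessDet f x ^ (2 / 3 : ℝ)) ^ 2)
      (hessDet f x) :=
    ((Real.hasDerivAt_rpow_const (Or.inl (hD x).ne')).const_add 1).inv (by linarith)
  unfold weight
  rw [pd_comp i h1 hd, rpow_sub_one (hD x).ne']
  field_simp
  ring

include hf hD in
lemma pd_cutoff (T : ℝ) (i : Fin 2) (x : Fin 2 → ℝ) :
    pd i (cutoff f T) x =
      (max 0 (T - log (exhaustion f x))) ^ 2 * pd i (weight f) x -
      2 * weight f x * max 0 (T - log (exhaustion f x)) *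
        (pd i (exhaustion f) x / exhaustion f x) := by
  have hE : exhaustion f x ≠ 0 := (zero_lt_one.trans_le (one_le_exhaustion hD x)).ne'
  have hm := (contDiff_weight hf hD).diffAt x
  have hl := (contDiff_log_exhaustion hf hD T).diffAt x
  have he := (contDiff_exhaustion hf hD).diffAt x
  have hη : DifferentiableAt ℝ (fun y => (max 0 (T - log (exhaustion f y))) ^ 2) x :=
    (contDiff_max_zero_sq.comp ((contDiff_log_exhaustion hf hD T).of_le
      (by exact_mod_cast le_top))).differentiable (by simp) x
  unfold cutoff
  rw [pd_mul i hm hη, pd_comp i (hasDerivAt_max_zero_sq _) hl,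
    pd_sub i (by fun_prop) (he.log hE), pd_const, pd_log i he hE]
  ring

include hD in
lemma cutoff_eq_zero {T : ℝ} {x : Fin 2 → ℝ} (hx : exp T ≤ exhaustion f x) :
    max 0 (T - log (exhaustion f x)) = 0 := by
  have h1 : 0 < exhaustion f x := zero_lt_one.trans_le (one_le_exhaustion hD x)
  have : T ≤ log (exhaustion f x) := (Real.le_log_iff_exp_le h1).2 hx
  exact max_eq_left (by linarith)

include hD in
lemma exp_le_exhaustion_of_notMem {T : ℝ} {x : Fin 2 → ℝ}
    (hx : x ∉ Set.Icc (fun _ => -exp (T / 2)) (fun _ : Fin 2 => exp (T / 2))) :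
    exp T ≤ exhaustion f x := by
  have h1 := normSq_le_exhaustion hD x
  have h2 : exp T = exp (T / 2) ^ 2 := by rw [← Real.exp_nat_mul]; congr 1; push_cast; ring
  by_contra! hlt
  have key : ∀ i, |x i| ≤ exp (T / 2) := by
    intro i
    refine abs_le_of_sq_le_sq ?_ (exp_pos _).le
    fin_cases i <;> simp <;> nlinarith [sq_nonneg (x 0), sq_nonneg (x 1)]
  exact hx ⟨fun i => (abs_le.1 (key i)).1, fun i => (abs_le.1 (key i)).2⟩

include hD in
lemma hasCompactSupport_cutoff (T : ℝ) : HasCompactSupport (cutoff f T) := by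
  refine HasCompactSupport.intro
    (isCompact_Icc (a := fun _ => -exp (T / 2)) (b := fun _ : Fin 2 => exp (T / 2)))
    fun x hx => ?_
  simp [cutoff, cutoff_eq_zero hD (exp_le_exhaustion_of_notMem hD hx)]

end Cutoff

/-! ### The weighted energy estimate -/

section Energy

variable {f ℓ : (Fin 2 → ℝ) → ℝ} (hf : ContDiff ℝ (⊤ : ℕ∞) f)
  (hr : ∀ x, 0 < pd 0 (pd 0 f) x) (hD : ∀ x, 0 < hessDet f x)

/-- The squared norm of the gradient of `ℓ` for the cofactor matrix of the Hessian of `f`. -/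
noncomputable def cofGradSq (f ℓ : (Fin 2 → ℝ) → ℝ) (x : Fin 2 → ℝ) : ℝ :=
  cofForm (pd 0 (pd 0 f) x) (pd 0 (pd 1 f) x) (pd 1 (pd 1 f) x)
    (pd 0 ℓ x) (pd 1 ℓ x) (pd 0 ℓ x) (pd 1 ℓ x)

/-- The linearised Monge-Ampère operator `∑ F^{ij} ∂ᵢ∂ⱼ ℓ`. -/
noncomputable def cofLap (f ℓ : (Fin 2 → ℝ) → ℝ) (x : Fin 2 → ℝ) : ℝ :=
  pd 1 (pd 1 f) x * pd 0 (pd 0 ℓ) x - 2 * pd 0 (pd 1 f) x * pd 0 (pd 1 ℓ) x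
    + pd 0 (pd 0 f) x * pd 1 (pd 1 ℓ) x

include hf in
/-- The cofactor matrix of a Hessian is divergence free. -/
lemma pd_cofactor_add_eq_cofLap (hl : ContDiff ℝ (⊤ : ℕ∞) ℓ) (x : Fin 2 → ℝ) :
    pd 0 (fun y => pd 1 (pd 1 f) y * pd 0 ℓ y - pd 0 (pd 1 f) y * pd 1 ℓ y) x +
      pd 1 (fun y => pd 0 (pd 0 f) y * pd 1 ℓ y - pd 0 (pd 1 f) y * pd 0 ℓ y) x =
      cofLap f ℓ x := by
  have d0 := (contDiff_pd 0 hl).diffAt x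
  have d1 := (contDiff_pd 1 hl).diffAt x
  have hr' := (contDiff_pd 0 (contDiff_pd 0 hf)).diffAt x
  have hs := (contDiff_pd 0 (contDiff_pd 1 hf)).diffAt x
  have ht := (contDiff_pd 1 (contDiff_pd 1 hf)).diffAt x
  rw [pd_sub 0 (by fun_prop) (by fun_prop), pd_sub 1 (by fun_prop) (by fun_prop), pd_mul 0 ht d0,
    pd_mul 0 hs d1, pd_mul 1 hr' d1, pd_mul 1 hs d0]
  have e1 : pd 0 (pd 1 (pd 1 f)) x = pd 1 (pd 0 (pd 1 f)) x := by
    rw [pd_comm 0 1 (contDiff_pd 1 hf)]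
  have e2 : pd 0 (pd 0 (pd 1 f)) x = pd 1 (pd 0 (pd 0 f)) x := by
    rw [pd_comm 0 1 hf, pd_comm 0 1 (contDiff_pd 0 hf)]
  have e3 : pd 1 (pd 0 ℓ) x = pd 0 (pd 1 ℓ) x := by rw [pd_comm 0 1 hl]
  rw [e1, e2, e3, cofLap]
  ring

include hf in
lemma continuous_cofGradSq (hl : ContDiff ℝ (⊤ : ℕ∞) ℓ) : Continuous (cofGradSq f ℓ) := by
  have d0 := (contDiff_pd 0 hl).continuous
  have d1 := (contDiff_pd 1 hl).continuous
  have hr' := (contDiff_pd 0 (contDiff_pd 0 hf)).continuous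
  have hs := (contDiff_pd 0 (contDiff_pd 1 hf)).continuous
  have ht := (contDiff_pd 1 (contDiff_pd 1 hf)).continuous
  unfold cofGradSq cofForm
  fun_prop

include hf hD in
lemma continuous_cost (i : Fin 2) :
    Continuous fun x => weight f x * pd i (pd i f) x / exhaustion f x :=
  ((contDiff_weight hf hD).continuous.mul (contDiff_pd i (contDiff_pd i hf)).continuous).div
    (contDiff_exhaustion hf hD).continuous
    fun x => (zero_lt_one.trans_le (one_le_exhaustion hD x)).ne'

include hf hr hD in
lemma integral_cutoff_mul_cofGradSq_le (hl : ContDiff ℝ (⊤ : ℕ∞) ℓ) {c μ : ℝ} (hc : 3 / 4 ≤ c)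
    (hμ0 : 0 ≤ μ) (hμ1 : μ ≤ 1) (hdiv : ∀ x, cofLap f ℓ x = c * cofGradSq f ℓ x)
    (hDl : ∀ x i, pd i (hessDet f) x = μ * hessDet f x * pd i ℓ x) (T : ℝ) :
    ∫ x, cutoff f T x * cofGradSq f ℓ x ≤
      4608 * ∫ x in Set.Icc (fun _ => -exp (T / 2)) (fun _ : Fin 2 => exp (T / 2)),
        (weight f x * pd 0 (pd 0 f) x / exhaustion f x +
          weight f x * pd 1 (pd 1 f) x / exhaustion f x) := by
  set B := Set.Icc (fun _ => -exp (T / 2)) (fun _ : Fin 2 => exp (T / 2)) with hB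
  set g : (Fin 2 → ℝ) → ℝ := fun x => weight f x * pd 0 (pd 0 f) x / exhaustion f x +
    weight f x * pd 1 (pd 1 f) x / exhaustion f x with hg
  have s0 := contDiff_pd 0 hl
  have s1 := contDiff_pd 1 hl
  have sr := contDiff_pd 0 (contDiff_pd 0 hf)
  have ss := contDiff_pd 0 (contDiff_pd 1 hf)
  have st := contDiff_pd 1 (contDiff_pd 1 hf)
  have hM := contDiff_cutoff hf hD T
  have hMc := hasCompactSupport_cutoff (f := f) hD T
  obtain ⟨i0, z0⟩ := integral_mul_pd_add_pd_mul_eq_zero 0 hM hMc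
    (((st.mul s0).sub (ss.mul s1)).of_le (by exact_mod_cast le_top))
  obtain ⟨i1, z1⟩ := integral_mul_pd_add_pd_mul_eq_zero 1 hM hMc
    (((sr.mul s1).sub (ss.mul s0)).of_le (by exact_mod_cast le_top))
  have hgc : Continuous g := (continuous_cost hf hD 0).add (continuous_cost hf hD 1)
  have hgi : Integrable (B.indicator g) :=
    (hgc.continuousOn.integrableOn_compact isCompact_Icc).integrable_indicator measurableSet_Icc
  have hLi : Integrable fun x => cutoff f T x * cofGradSq f ℓ x :=
    (hM.continuous.mul (continuous_cofGradSq hf hl)).integrable_of_hasCompactSupport hMc.mul_right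
  have hpt : ∀ x, cutoff f T x * cofGradSq f ℓ x ≤
      24 * ((cutoff f T x *
          pd 0 (fun y => pd 1 (pd 1 f) y * pd 0 ℓ y - pd 0 (pd 1 f) y * pd 1 ℓ y) x +
        pd 0 (cutoff f T) x * (pd 1 (pd 1 f) x * pd 0 ℓ x - pd 0 (pd 1 f) x * pd 1 ℓ x)) +
        (cutoff f T x *
          pd 1 (fun y => pd 0 (pd 0 f) y * pd 1 ℓ y - pd 0 (pd 1 f) y * pd 0 ℓ y) x +
        pd 1 (cutoff f T) x * (pd 0 (pd 0 f) x * pd 1 ℓ x - pd 0 (pd 1 f) x * pd 0 ℓ x)))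
      + 4608 * B.indicator g x := by
    intro x
    by_cases hx : x ∈ B
    · have hE : 0 < exhaustion f x := zero_lt_one.trans_le (one_le_exhaustion hD x)
      have hm := weight_pos hD x
      have hdx := hD x
      have hp : pd 1 (pd 0 f) x = pd 0 (pd 1 f) x := by rw [pd_comm 0 1 hf]
      have htp : 0 ≤ pd 1 (pd 1 f) x := by
        have h1 := hr x
        have h2 := hD x
        unfold hessDet at h2
        by_contra! h
        nlinarith [sq_nonneg (pd 0 (pd 1 f) x), mul_pos h1 (neg_pos.2 h)]
      have hk : 1 / 12 ≤ c - 2 / 3 * (1 - weight f x) * μ := by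
        nlinarith [mul_nonneg hm.le hμ0]
      have hv := cofForm_gradient_le (hr x) (hD x) (x 0) (x 1) (pd 0 f x) (pd 1 f x)
      have hv' := hv.trans (b := _) (c := 2 * ((pd 0 (pd 0 f) x + pd 1 (pd 1 f) x) *
        exhaustion f x)) (by
          have : 0 ≤ pd 0 (pd 0 f) x + pd 1 (pd 1 f) x := add_nonneg (hr x).le htp
          gcongr
          simp only [exhaustion, hessDet]
          linarith)
      have key := energy_pointwise (hr x) (hD x) (η := max 0 (T - log (exhaustion f x)))
        (e := (pd 0 f x ^ 2 + pd 1 f x ^ 2) / hessDet f x * μ) (l₀ := pd 0 ℓ x) (l₁ := pd 1 ℓ x)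
        hm (le_max_left _ _) hE hk (by positivity) hv'
      have hq : ∀ i, pd i (hessDet f) x / hessDet f x = μ * pd i ℓ x := by
        intro i
        rw [hDl x i]
        field_simp
      have hL := pd_cofactor_add_eq_cofLap hf hl x
      rw [hdiv x] at hL
      rw [Set.indicator_of_mem hx, pd_cutoff hf hD, pd_cutoff hf hD, pd_weight hf hD,
        pd_weight hf hD, pd_exhaustion hf hD, pd_exhaustion hf hD, hq, hq, hp]
      have hcut : cutoff f T x = weight f x * (max 0 (T - log (exhaustion f x))) ^ 2 := rfl
      rw [hcut]
      have hgx : g x = weight f x * (pd 0 (pd 0 f) x + pd 1 (pd 1 f) x) / exhaustion f x := by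
        simp only [hg]; ring
      rw [hgx]
      have hL' := congrArg
        (fun z => weight f x * (max 0 (T - log (exhaustion f x))) ^ 2 * z) hL
      simp only [cofGradSq] at hL' ⊢
      rw [← hL'] at key
      simp only [hessDet] at key ⊢
      have key' := add_le_add (mul_le_mul_of_nonneg_left key (by norm_num : (0 : ℝ) ≤ 24))
        (le_refl (4608 * (weight f x * (pd 0 (pd 0 f) x + pd 1 (pd 1 f) x) / exhaustion f x)))
      refine (le_of_eq ?_).trans (key'.trans (le_of_eq ?_))
      · ring
      · ring
    · have h0 := cutoff_eq_zero hD (exp_le_exhaustion_of_notMem hD hx)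
      rw [Set.indicator_of_notMem hx, pd_cutoff hf hD, pd_cutoff hf hD]
      simp [cutoff, h0]
  calc ∫ x, cutoff f T x * cofGradSq f ℓ x ≤ _ :=
        integral_mono hLi (((i0.add i1).const_mul 24).add (hgi.const_mul 4608)) hpt
    _ = _ := by
        rw [integral_add' ((i0.add i1).const_mul 24) (hgi.const_mul 4608), integral_const_mul,
          integral_const_mul, integral_add' i0 i1, z0, z1, integral_indicator measurableSet_Icc,
          add_zero, mul_zero, zero_add]

end Energy

/-! ### The cost of the cutoff -/

section Cost

/-- The kernel `(1 + τ²)^(-2/3)`. -/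
noncomputable def costKernel (τ : ℝ) : ℝ := (1 + τ ^ 2) ^ (-(4 / 3) / 2 : ℝ)

lemma integrable_costKernel : Integrable costKernel := by
  have h := integrable_rpow_neg_one_add_norm_sq (E := ℝ) (μ := volume) (r := 4 / 3)
    (by rw [Module.finrank_self]; norm_num)
  simp only [Real.norm_eq_abs, sq_abs] at h
  exact h

lemma costKernel_nonneg (τ : ℝ) : 0 ≤ costKernel τ := by unfold costKernel; positivity

lemma continuous_costKernel : Continuous costKernel := by
  unfold costKernel
  exact Continuous.rpow_const (by fun_prop) fun τ => Or.inl (by positivity)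

lemma intervalIntegral_costKernel_le (a b : ℝ) :
    ∫ τ in a..b, costKernel τ ≤ ∫ τ, costKernel τ := by
  rcases le_total a b with h | h
  · rw [intervalIntegral.integral_of_le h]
    exact setIntegral_le_integral integrable_costKernel
      (Filter.Eventually.of_forall costKernel_nonneg)
  · rw [intervalIntegral.integral_of_ge h]
    have h1 : 0 ≤ ∫ τ in Set.Ioc b a, costKernel τ :=
      integral_nonneg costKernel_nonneg
    have h2 : 0 ≤ ∫ τ, costKernel τ := integral_nonneg costKernel_nonneg
    linarith

lemma one_add_rpow_le {y : ℝ} (hy : 0 ≤ y) :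
    (1 + y) ^ (2 / 3 : ℝ) ≤ 1 + y ^ (2 / 3 : ℝ) := by
  have h := NNReal.rpow_add_le_add_rpow 1 (y.toNNReal) (p := 2 / 3) (by norm_num) (by norm_num)
  have h' := NNReal.coe_le_coe.2 h
  simpa [Real.coe_toNNReal y hy] using h'

lemma inv_one_add_rpow_div_le {D E σ p : ℝ} (hD : 0 < D) (hσ : 0 < σ) (hE : σ ^ 2 ≤ E)
    (hp : p ^ 2 ≤ D * E) :
    (1 + D ^ (2 / 3 : ℝ))⁻¹ / E ≤ σ⁻¹ * (costKernel (p / σ) * σ⁻¹) := by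
  have h1 : 1 ≤ E / σ ^ 2 := (one_le_div (by positivity)).2 hE
  have h2 : (p / σ) ^ 2 ≤ D * (E / σ ^ 2) := by
    rw [div_pow, ← mul_div_assoc]
    gcongr
  have h3 : (1 + (p / σ) ^ 2) ^ (2 / 3 : ℝ) ≤ 1 + D ^ (2 / 3 : ℝ) * (E / σ ^ 2) := by
    calc (1 + (p / σ) ^ 2) ^ (2 / 3 : ℝ) ≤ 1 + ((p / σ) ^ 2) ^ (2 / 3 : ℝ) :=
          one_add_rpow_le (by positivity)
      _ ≤ 1 + (D * (E / σ ^ 2)) ^ (2 / 3 : ℝ) := by gcongr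
      _ = 1 + D ^ (2 / 3 : ℝ) * (E / σ ^ 2) ^ (2 / 3 : ℝ) := by
          rw [mul_rpow hD.le (by positivity)]
      _ ≤ 1 + D ^ (2 / 3 : ℝ) * (E / σ ^ 2) := by
          gcongr
          calc (E / σ ^ 2) ^ (2 / 3 : ℝ) ≤ (E / σ ^ 2) ^ (1 : ℝ) :=
                rpow_le_rpow_of_exponent_le h1 (by norm_num)
            _ = E / σ ^ 2 := rpow_one _
  have h4 : costKernel (p / σ) = ((1 + (p / σ) ^ 2) ^ (2 / 3 : ℝ))⁻¹ := by
    unfold costKernel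
    rw [← rpow_neg (by positivity)]
    norm_num
  have hk : 0 < (1 + (p / σ) ^ 2) ^ (2 / 3 : ℝ) := by positivity
  have h5 : σ ^ 2 * (1 + (p / σ) ^ 2) ^ (2 / 3 : ℝ) ≤ (1 + D ^ (2 / 3 : ℝ)) * E := by
    calc σ ^ 2 * (1 + (p / σ) ^ 2) ^ (2 / 3 : ℝ)
        ≤ σ ^ 2 * (1 + D ^ (2 / 3 : ℝ) * (E / σ ^ 2)) := by gcongr
      _ = σ ^ 2 + D ^ (2 / 3 : ℝ) * E := by field_simp
      _ ≤ (1 + D ^ (2 / 3 : ℝ)) * E := by linarith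
  rw [h4]
  calc (1 + D ^ (2 / 3 : ℝ))⁻¹ / E = ((1 + D ^ (2 / 3 : ℝ)) * E)⁻¹ := by
        rw [mul_inv, div_eq_mul_inv]
    _ ≤ (σ ^ 2 * (1 + (p / σ) ^ 2) ^ (2 / 3 : ℝ))⁻¹ := inv_anti₀ (by positivity) h5
    _ = _ := by rw [mul_inv, sq, mul_inv]; ring

lemma intervalIntegral_cost_le {w g g' : ℝ → ℝ} {σ R : ℝ} (hR : 0 ≤ R) (hσ : 0 < σ)
    (hg : ∀ y, HasDerivAt g (g' y) y) (hg' : Continuous g') (hw : Continuous w)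
    (h : ∀ y, w y ≤ σ⁻¹ * (costKernel (g y / σ) * σ⁻¹) * g' y) :
    ∫ y in -R..R, w y ≤ (∫ τ, costKernel τ) * σ⁻¹ := by
  have hgc : Continuous g := continuous_iff_continuousAt.2 fun y => (hg y).continuousAt
  have h1 : ∀ y, HasDerivAt (fun y => g y / σ) (g' y / σ) y := fun y => (hg y).div_const σ
  have h2 : ∫ y in -R..R, (costKernel ∘ fun y => g y / σ) y * (g' y / σ) =
      ∫ τ in (g (-R) / σ)..(g R / σ), costKernel τ :=
    intervalIntegral.integral_comp_mul_deriv (fun y _ => h1 y) (by fun_prop)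
      continuous_costKernel
  have h3 := intervalIntegral_costKernel_le (g (-R) / σ) (g R / σ)
  have hk : Continuous fun y => costKernel (g y / σ) :=
    continuous_costKernel.comp (by fun_prop)
  calc ∫ y in -R..R, w y
      ≤ ∫ y in -R..R, σ⁻¹ * ((costKernel ∘ fun y => g y / σ) y * (g' y / σ)) := by
        refine intervalIntegral.integral_mono_on (by linarith) (hw.intervalIntegrable _ _)
          ((continuous_const.mul (hk.mul (by fun_prop))).intervalIntegrable _ _)
          fun y _ => (h y).trans_eq ?_
        simp only [Function.comp]
        ring
    _ = σ⁻¹ * ∫ τ in (g (-R) / σ)..(g R / σ), costKernel τ := by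
        rw [intervalIntegral.integral_const_mul, h2]
    _ ≤ σ⁻¹ * ∫ τ, costKernel τ := by gcongr
    _ = _ := mul_comm _ _

lemma setIntegral_box_eq {h : (Fin 2 → ℝ) → ℝ} (a b : ℝ) :
    ∫ x in Set.Icc (fun _ => a) (fun _ : Fin 2 => b), h x =
      ∫ z in Set.Icc a b ×ˢ Set.Icc a b, h ![z.1, z.2] := by
  have hp := (volume_preserving_finTwoArrow ℝ).symm
  rw [← hp.setIntegral_preimage_emb (MeasurableEquiv.measurableEmbedding _) h]
  congr 1
  congr 1
  ext z
  simp [MeasurableEquiv.finTwoArrow, Set.mem_Icc, Pi.le_def, Prod.le_def, Fin.forall_fin_two]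

lemma continuous_vec_two {α : Type*} [TopologicalSpace α] {u v : α → ℝ} (hu : Continuous u)
    (hv : Continuous v) : Continuous fun z => ![u z, v z] := by
  refine continuous_pi fun i => ?_
  fin_cases i <;> simpa

lemma setIntegral_box_le {h : (Fin 2 → ℝ) → ℝ} (hh : Continuous h) {C : ℝ → ℝ}
    (hC : Continuous C) {R : ℝ} (hR : 0 ≤ R)
    (hle : (∀ y, ∫ x in -R..R, h ![x, y] ≤ C y) ∨ ∀ y, ∫ x in -R..R, h ![y, x] ≤ C y) :
    ∫ x in Set.Icc (fun _ => -R) (fun _ : Fin 2 => R), h x ≤ ∫ y in -R..R, C y := by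
  have hRR : -R ≤ R := by linarith
  have hc : Continuous fun z : ℝ × ℝ => h ![z.1, z.2] :=
    hh.comp (continuous_vec_two continuous_fst continuous_snd)
  have hi : IntegrableOn (fun z : ℝ × ℝ => h ![z.1, z.2]) (Set.Icc (-R) R ×ˢ Set.Icc (-R) R) :=
    hc.continuousOn.integrableOn_compact (isCompact_Icc.prod isCompact_Icc)
  have hCi : IntegrableOn C (Set.Icc (-R) R) := hC.continuousOn.integrableOn_compact isCompact_Icc
  rw [setIntegral_box_eq, intervalIntegral.integral_of_le hRR, ← integral_Icc_eq_integral_Ioc,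
    Measure.volume_eq_prod]
  rw [Measure.volume_eq_prod] at hi
  have hi' := hi
  rw [IntegrableOn, ← Measure.prod_restrict] at hi'
  rcases hle with hle | hle
  · rw [← Measure.prod_restrict, integral_prod_symm _ hi']
    refine setIntegral_mono_on hi'.integral_prod_right hCi measurableSet_Icc fun y _ => ?_
    have := hle y
    rwa [intervalIntegral.integral_of_le hRR, ← integral_Icc_eq_integral_Ioc] at this
  · rw [setIntegral_prod _ hi]
    refine setIntegral_mono_on hi'.integral_prod_left hCi measurableSet_Icc fun y _ => ?_
    have := hle y
    rwa [intervalIntegral.integral_of_le hRR, ← integral_Icc_eq_integral_Ioc] at this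

lemma intervalIntegral_inv_sqrt_le {T : ℝ} (hT : 0 ≤ T) :
    ∫ y in -exp (T / 2)..exp (T / 2), (√(1 + y ^ 2))⁻¹ ≤ 2 * (T + 2) := by
  have hc : Continuous fun y : ℝ => (√(1 + y ^ 2))⁻¹ :=
    Continuous.inv₀ (by fun_prop) fun y => (Real.sqrt_pos.2 (by positivity)).ne'
  rw [intervalIntegral.integral_eq_sub_of_hasDerivAt (fun y _ => hasDerivAt_arsinh y)
    (hc.intervalIntegrable _ _), arsinh_neg]
  have h1 : arsinh (exp (T / 2)) ≤ T + 2 := by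
    have h2 : 1 ≤ exp (T / 2) := Real.one_le_exp (by linarith)
    have h3 : √(1 + exp (T / 2) ^ 2) ≤ 1 + exp (T / 2) :=
      Real.sqrt_le_iff.2 ⟨by positivity, by nlinarith⟩
    have h4 : exp (T / 2) + √(1 + exp (T / 2) ^ 2) ≤ exp (T + 2) := by
      have h5 : exp (T + 2) = exp (T / 2) * exp (T / 2 + 2) := by rw [← exp_add]; ring_nf
      have h6 : 3 ≤ exp (T / 2 + 2) := by linarith [Real.add_one_le_exp (T / 2 + 2)]
      rw [h5]
      nlinarith
    rw [arsinh, Real.log_le_iff_le_exp (by positivity)]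
    exact h4
  linarith

variable {f : (Fin 2 → ℝ) → ℝ} (hf : ContDiff ℝ (⊤ : ℕ∞) f) (hD : ∀ x, 0 < hessDet f x)

lemma hasDerivAt_slice {u : (Fin 2 → ℝ) → ℝ} (hu : ContDiff ℝ (⊤ : ℕ∞) u) (y z : ℝ) :
    HasDerivAt (fun z => u ![z, y]) (pd 0 u ![z, y]) z ∧
      HasDerivAt (fun z => u ![y, z]) (pd 1 u ![y, z]) z := by
  have h0 : HasDerivAt (fun z : ℝ => ![z, y]) (Pi.single 0 1) z := by
    rw [hasDerivAt_pi]
    intro i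
    fin_cases i
    · simpa using hasDerivAt_id' z
    · simpa using hasDerivAt_const z y
  have h1 : HasDerivAt (fun z : ℝ => ![y, z]) (Pi.single 1 1) z := by
    rw [hasDerivAt_pi]
    intro i
    fin_cases i
    · simpa using hasDerivAt_const z y
    · simpa using hasDerivAt_id' z
  exact ⟨(hu.diffAt _).hasFDerivAt.comp_hasDerivAt z h0,
    (hu.diffAt _).hasFDerivAt.comp_hasDerivAt z h1⟩

include hD in
lemma weight_div_exhaustion_le (i j : Fin 2) (x : Fin 2 → ℝ) :
    weight f x / exhaustion f x ≤ (√(1 + x j ^ 2))⁻¹ *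
      (costKernel (pd i f x / √(1 + x j ^ 2)) * (√(1 + x j ^ 2))⁻¹) := by
  refine inv_one_add_rpow_div_le (hD x) (Real.sqrt_pos.2 (by positivity)) ?_ ?_
  · rw [Real.sq_sqrt (by positivity)]
    refine le_trans ?_ (normSq_le_exhaustion hD x)
    fin_cases j <;> simp <;> nlinarith [sq_nonneg (x 0), sq_nonneg (x 1)]
  · have h1 : hessDet f x * exhaustion f x =
        hessDet f x * (1 + (x 0 ^ 2 + x 1 ^ 2)) + (pd 0 f x ^ 2 + pd 1 f x ^ 2) := by
      have := (hD x).ne'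
      unfold exhaustion
      field_simp
      ring
    have h2 : 0 ≤ hessDet f x * (1 + (x 0 ^ 2 + x 1 ^ 2)) :=
      mul_nonneg (hD x).le (by positivity)
    rw [h1]
    fin_cases i <;> simp <;> nlinarith [sq_nonneg (pd 0 f x), sq_nonneg (pd 1 f x)]

include hf hD in
lemma setIntegral_cost_le (hpos : ∀ i x, 0 ≤ pd i (pd i f) x) (i : Fin 2) {T : ℝ} (hT : 0 ≤ T) :
    ∫ x in Set.Icc (fun _ => -exp (T / 2)) (fun _ : Fin 2 => exp (T / 2)),
      weight f x * pd i (pd i f) x / exhaustion f x ≤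
      (∫ τ, costKernel τ) * (2 * (T + 2)) := by
  have hK : 0 ≤ ∫ τ, costKernel τ := integral_nonneg costKernel_nonneg
  have hc : Continuous fun y : ℝ => (√(1 + y ^ 2))⁻¹ :=
    Continuous.inv₀ (by fun_prop) fun y => (Real.sqrt_pos.2 (by positivity)).ne'
  have hσ : ∀ y : ℝ, 0 < √(1 + y ^ 2) := fun y => Real.sqrt_pos.2 (by positivity)
  have hle : ∀ j x, weight f x * pd i (pd i f) x / exhaustion f x ≤ (√(1 + x j ^ 2))⁻¹ *
      (costKernel (pd i f x / √(1 + x j ^ 2)) * (√(1 + x j ^ 2))⁻¹) * pd i (pd i f) x := by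
    intro j x
    have := mul_le_mul_of_nonneg_right (weight_div_exhaustion_le hD i j x) (hpos i x)
    rwa [div_mul_eq_mul_div] at this
  have hcost := continuous_cost hf hD i
  have hpc := (contDiff_pd i (contDiff_pd i hf)).continuous
  calc _ ≤ ∫ y in -exp (T / 2)..exp (T / 2), (∫ τ, costKernel τ) * (√(1 + y ^ 2))⁻¹ := by
        refine setIntegral_box_le hcost (continuous_const.mul hc) (exp_pos _).le ?_
        fin_cases i
        · left
          intro y
          have hv : Continuous fun z : ℝ => ![z, y] :=
            continuous_vec_two continuous_id continuous_const
          exact intervalIntegral_cost_le (exp_pos _).le (hσ y)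
            (fun z => (hasDerivAt_slice (contDiff_pd 0 hf) y z).1) (hpc.comp hv)
            (hcost.comp hv) fun z => hle 1 ![z, y]
        · right
          intro y
          have hv : Continuous fun z : ℝ => ![y, z] :=
            continuous_vec_two continuous_const continuous_id
          exact intervalIntegral_cost_le (exp_pos _).le (hσ y)
            (fun z => (hasDerivAt_slice (contDiff_pd 1 hf) y z).2) (hpc.comp hv)
            (hcost.comp hv) fun z => hle 0 ![y, z]
    _ ≤ _ := by
        rw [intervalIntegral.integral_const_mul]
        exact mul_le_mul_of_nonneg_left (intervalIntegral_inv_sqrt_le hT) hK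

end Cost

/-! ### A Liouville property -/

section Liouville

variable {f ℓ : (Fin 2 → ℝ) → ℝ}

lemma exists_mul_sq_gt {κ A T₀ : ℝ} (hκ : 0 < κ) (hA : 0 ≤ A) :
    ∃ T, T₀ ≤ T ∧ 0 ≤ T ∧ A * (T + 2) < κ * T ^ 2 := by
  refine ⟨max T₀ (3 * A / κ + 1), le_max_left _ _, ?_, ?_⟩
  · exact le_trans (by positivity) (le_max_right _ _)
  · have h1 : 3 * A / κ + 1 ≤ max T₀ (3 * A / κ + 1) := le_max_right _ _
    generalize max T₀ (3 * A / κ + 1) = T at h1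
    have h2 : 0 ≤ 3 * A / κ := by positivity
    have h4 : 3 * A + κ ≤ κ * T := by
      calc 3 * A + κ = κ * (3 * A / κ + 1) := by field_simp
        _ ≤ κ * T := by gcongr
    nlinarith

lemma pd_eq_zero_of_cofLap_eq (hf : ContDiff ℝ (⊤ : ℕ∞) f)
    (hpos : ∀ i x, 0 < pd i (pd i f) x) (hD : ∀ x, 0 < hessDet f x)
    (hl : ContDiff ℝ (⊤ : ℕ∞) ℓ) {c μ : ℝ} (hc : 3 / 4 ≤ c)
    (hμ0 : 0 ≤ μ) (hμ1 : μ ≤ 1) (hdiv : ∀ x, cofLap f ℓ x = c * cofGradSq f ℓ x)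
    (hDl : ∀ x i, pd i (hessDet f) x = μ * hessDet f x * pd i ℓ x) (x : Fin 2 → ℝ) (i : Fin 2) :
    pd i ℓ x = 0 := by
  have hqnn : ∀ y, 0 ≤ cofGradSq f ℓ y := fun y => cofForm_self_nonneg (hpos 0 y) (hD y) _ _
  suffices h0 : cofGradSq f ℓ x = 0 by
    have := eq_zero_of_cofForm_self_eq_zero (hpos 0 x) (hD x) h0
    fin_cases i
    exacts [this.1, this.2]
  by_contra hne
  have hq : 0 < cofGradSq f ℓ x := lt_of_le_of_ne (hqnn x) (Ne.symm hne)
  have hEc := (contDiff_exhaustion hf hD).continuous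
  have hhc : Continuous fun y => weight f y * cofGradSq f ℓ y :=
    (contDiff_weight hf hD).continuous.mul (continuous_cofGradSq hf hl)
  set h₀ := weight f x * cofGradSq f ℓ x with hh₀
  have hh : 0 < h₀ := mul_pos (weight_pos hD x) hq
  have hev : ∀ᶠ y in 𝓝 x, h₀ / 2 < weight f y * cofGradSq f ℓ y ∧
      exhaustion f y < exhaustion f x + 1 :=
    (hhc.continuousAt.eventually (lt_mem_nhds (by linarith))).and
      (hEc.continuousAt.eventually (gt_mem_nhds (by linarith)))
  obtain ⟨δ, hδ, hball⟩ := Metric.eventually_nhds_iff_ball.1 hev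
  have hvol : 0 < volume.real (Metric.ball x δ) :=
    ENNReal.toReal_pos (Metric.measure_ball_pos volume x hδ).ne' measure_ball_lt_top.ne
  have hK : 0 ≤ ∫ τ, costKernel τ := integral_nonneg costKernel_nonneg
  obtain ⟨T, hT₀, hT, hlt⟩ := exists_mul_sq_gt (T₀ := 2 * log (exhaustion f x + 1))
    (κ := volume.real (Metric.ball x δ) * (h₀ / 8)) (A := 18432 * ∫ τ, costKernel τ)
    (by positivity) (by positivity)
  have hcost : ∫ x in Set.Icc (fun _ => -exp (T / 2)) (fun _ : Fin 2 => exp (T / 2)),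
        (weight f x * pd 0 (pd 0 f) x / exhaustion f x +
          weight f x * pd 1 (pd 1 f) x / exhaustion f x) ≤
      2 * ((∫ τ, costKernel τ) * (2 * (T + 2))) := by
    rw [integral_add ((continuous_cost hf hD 0).continuousOn.integrableOn_compact isCompact_Icc)
      ((continuous_cost hf hD 1).continuousOn.integrableOn_compact isCompact_Icc)]
    have h0 := setIntegral_cost_le hf hD (fun i x => (hpos i x).le) 0 hT
    have h1 := setIntegral_cost_le hf hD (fun i x => (hpos i x).le) 1 hT
    linarith
  have hle := integral_cutoff_mul_cofGradSq_le hf (hpos 0) hD hl hc hμ0 hμ1 hdiv hDl T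
  have hint : Integrable fun y => cutoff f T y * cofGradSq f ℓ y :=
    ((contDiff_cutoff hf hD T).continuous.mul
      (continuous_cofGradSq hf hl)).integrable_of_hasCompactSupport
      (hasCompactSupport_cutoff hD T).mul_right
  have hcutnn : ∀ y, 0 ≤ cutoff f T y := fun y =>
    mul_nonneg (weight_pos hD y).le (sq_nonneg _)
  have hlow : volume.real (Metric.ball x δ) * (h₀ / 8 * T ^ 2) ≤
      ∫ y, cutoff f T y * cofGradSq f ℓ y := by
    calc volume.real (Metric.ball x δ) * (h₀ / 8 * T ^ 2)
        = ∫ _ in Metric.ball x δ, h₀ / 8 * T ^ 2 := by simp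
      _ ≤ ∫ y in Metric.ball x δ, cutoff f T y * cofGradSq f ℓ y := by
          refine setIntegral_mono_on (integrableOn_const measure_ball_lt_top.ne)
            hint.integrableOn measurableSet_ball fun y hy => ?_
          obtain ⟨hy1, hy2⟩ := hball y hy
          have hE := zero_lt_one.trans_le (one_le_exhaustion hD y)
          have h1 : log (exhaustion f y) ≤ log (exhaustion f x + 1) := Real.log_le_log hE hy2.le
          have h2 : T / 2 ≤ max 0 (T - log (exhaustion f y)) :=
            le_trans (by linarith) (le_max_right _ _)
          calc h₀ / 8 * T ^ 2 = h₀ / 2 * (T / 2) ^ 2 := by ring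
            _ ≤ weight f y * cofGradSq f ℓ y * max 0 (T - log (exhaustion f y)) ^ 2 := by
                gcongr
                exact mul_nonneg (weight_pos hD y).le (hqnn y)
            _ = _ := by unfold cutoff; ring
      _ ≤ _ := setIntegral_le_integral hint
          (Filter.Eventually.of_forall fun y => mul_nonneg (hcutnn y) (hqnn y))
  nlinarith

end Liouville

/-! ### The differential equations for `log det D²f` and for `log ∂ᵢᵢf` -/

section Equations

variable {f g : (Fin 2 → ℝ) → ℝ}

lemma pd_log_eq (hg : ContDiff ℝ (⊤ : ℕ∞) g) (hpos : ∀ x, 0 < g x) (i : Fin 2) :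
    pd i (fun y => log (g y)) = fun x => pd i g x * (g x)⁻¹ := by
  funext x
  rw [pd_log i (hg.diffAt x) (hpos x).ne', div_eq_mul_inv]

lemma pd_pd_log_eq (hg : ContDiff ℝ (⊤ : ℕ∞) g) (hpos : ∀ x, 0 < g x) (i j : Fin 2)
    (x : Fin 2 → ℝ) :
    pd i (pd j (fun y => log (g y))) x =
      pd i (pd j g) x / g x - pd i g x * pd j g x / g x ^ 2 := by
  have hne := (hpos x).ne'
  have hinv : DifferentiableAt ℝ (fun y => (g y)⁻¹) x := (hg.diffAt x).inv hne
  rw [pd_log_eq hg hpos, pd_mul i ((contDiff_pd j hg).diffAt x) hinv,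
    pd_comp i (hasDerivAt_inv hne) (hg.diffAt x)]
  field_simp
  ring

lemma cofLap_log (hg : ContDiff ℝ (⊤ : ℕ∞) g) (hpos : ∀ x, 0 < g x)
    (h : ∀ x, g x * cofLap f g x = 2 * cofGradSq f g x) (x : Fin 2 → ℝ) :
    cofLap f (fun y => log (g y)) x = 1 * cofGradSq f (fun y => log (g y)) x := by
  have h1 := h x
  have hne := (hpos x).ne'
  unfold cofLap cofGradSq cofForm at *
  rw [pd_pd_log_eq hg hpos, pd_pd_log_eq hg hpos, pd_pd_log_eq hg hpos, pd_log_eq hg hpos,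
    pd_log_eq hg hpos]
  field_simp
  linarith

variable (hf : ContDiff ℝ (⊤ : ℕ∞) f)

include hf in
lemma pd_hessDet (i : Fin 2) :
    pd i (hessDet f) = fun x =>
      pd 0 (pd 0 f) x * pd i (pd 1 (pd 1 f)) x + pd 1 (pd 1 f) x * pd i (pd 0 (pd 0 f)) x
        - 2 * (pd 0 (pd 1 f) x * pd i (pd 0 (pd 1 f)) x) := by
  funext x
  have hr := (contDiff_pd 0 (contDiff_pd 0 hf)).diffAt x
  have hs := (contDiff_pd 0 (contDiff_pd 1 hf)).diffAt x
  have ht := (contDiff_pd 1 (contDiff_pd 1 hf)).diffAt x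
  unfold hessDet
  rw [pd_sub i (by fun_prop) (by fun_prop), pd_mul i hr ht, pd_sq i hs]
  ring

include hf in
lemma pd_pd_hessDet (i : Fin 2) (x : Fin 2 → ℝ) :
    pd i (pd i (hessDet f)) x =
      pd 0 (pd 0 f) x * pd i (pd i (pd 1 (pd 1 f))) x
        + 2 * (pd i (pd 0 (pd 0 f)) x * pd i (pd 1 (pd 1 f)) x)
        + pd 1 (pd 1 f) x * pd i (pd i (pd 0 (pd 0 f))) x
        - 2 * pd i (pd 0 (pd 1 f)) x ^ 2
        - 2 * (pd 0 (pd 1 f) x * pd i (pd i (pd 0 (pd 1 f))) x) := by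
  have sr := contDiff_pd 0 (contDiff_pd 0 hf)
  have ss := contDiff_pd 0 (contDiff_pd 1 hf)
  have st := contDiff_pd 1 (contDiff_pd 1 hf)
  have hr := sr.diffAt x
  have hs := ss.diffAt x
  have ht := st.diffAt x
  have hr' := (contDiff_pd i sr).diffAt x
  have hs' := (contDiff_pd i ss).diffAt x
  have ht' := (contDiff_pd i st).diffAt x
  rw [pd_hessDet hf, pd_sub i (by fun_prop) (by fun_prop), pd_add i (by fun_prop) (by fun_prop),
    pd_mul i hr ht', pd_mul i ht hr', pd_const_mul i _ (by fun_prop), pd_mul i hs hs']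
  ring

include hf in
lemma pd_one_hess : pd 1 (pd 0 (pd 0 f)) = pd 0 (pd 0 (pd 1 f)) := by
  rw [pd_comm 1 0 (contDiff_pd 0 hf), pd_comm 1 0 hf]

include hf in
lemma pd_zero_hess : pd 0 (pd 1 (pd 1 f)) = pd 1 (pd 0 (pd 1 f)) :=
  pd_comm 0 1 (contDiff_pd 1 hf)

include hf in
/-- If the Hessian determinant is constant, then `1 / ∂ᵢᵢf` solves the linearised equation. -/
lemma mul_cofLap_pd_pd (hD : ∀ i x, pd i (hessDet f) x = 0) (i : Fin 2) (x : Fin 2 → ℝ) :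
    pd i (pd i f) x * cofLap f (pd i (pd i f)) x = 2 * cofGradSq f (pd i (pd i f)) x := by
  have h1 : pd i (hessDet f) x = 0 := hD i x
  have h2 : pd i (pd i (hessDet f)) x = 0 := by
    rw [show pd i (hessDet f) = fun _ => 0 from funext (hD i), pd_const]
  rw [pd_pd_hessDet hf] at h2
  rw [pd_hessDet hf] at h1
  have ss := contDiff_pd 0 (contDiff_pd 1 hf)
  have e1 := pd_one_hess hf
  have e2 := pd_zero_hess hf
  have e3 := pd_comm 0 1 ss
  have e4 : pd 1 (pd 1 (pd 0 (pd 0 f))) = pd 0 (pd 0 (pd 1 (pd 1 f))) := by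
    rw [e1, e2, e3]
  have e5 : pd 0 (pd 1 (pd 1 (pd 1 f))) = pd 1 (pd 1 (pd 0 (pd 1 f))) := by
    rw [pd_comm 0 1 (contDiff_pd 1 (contDiff_pd 1 hf)), e2]
  have e6 : pd 0 (pd 1 (pd 0 (pd 0 f))) = pd 0 (pd 0 (pd 0 (pd 1 f))) := by rw [e1]
  unfold cofLap cofGradSq cofForm
  fin_cases i
  · simp only [Fin.zero_eta, Fin.isValue] at *
    rw [e6, e4, e1]
    linear_combination pd 0 (pd 0 f) x * h2 - 2 * pd 0 (pd 0 (pd 0 f)) x * h1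
  · simp only [Fin.mk_one, Fin.isValue] at *
    rw [e5, ← e4, e2]
    linear_combination pd 1 (pd 1 f) x * h2 - 2 * pd 1 (pd 1 (pd 1 f)) x * h1

include hf in
lemma det_hess (x : Fin 2 → ℝ) : (hess f x).det = hessDet f x := by
  rw [Matrix.det_fin_two]
  simp only [hess, hessDet, Matrix.of_apply]
  rw [pd_comm 1 0 hf]
  ring

include hf in
lemma cofLap_log_hessDet {a : ℝ} (ha : a ≠ 0) (hD : ∀ x, 0 < hessDet f x)
    (hpde : PDE1 f a Set.univ) (x : Fin 2 → ℝ) :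
    cofLap f (fun y => log (hessDet f y)) x =
      -a * cofGradSq f (fun y => log (hessDet f y)) x := by
  set ℓ : (Fin 2 → ℝ) → ℝ := fun y => log (hessDet f y) with hℓ
  have sl : ContDiff ℝ (⊤ : ℕ∞) ℓ := (contDiff_hessDet hf).log fun y => (hD y).ne'
  have hw : (fun y => (hess f y).det ^ a) = fun y => exp (a * ℓ y) := by
    funext y
    rw [det_hess hf, Real.rpow_def_of_pos (hD y), mul_comm]
  have hal : ∀ y, DifferentiableAt ℝ (fun z => a * ℓ z) y := fun y => (sl.diffAt y).const_mul a
  have h1 : ∀ (i : Fin 2) y, pd i (fun z => exp (a * ℓ z)) y =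
      exp (a * ℓ y) * (a * pd i ℓ y) := by
    intro i y
    rw [pd_comp i (Real.hasDerivAt_exp _) (hal y), pd_const_mul i a (sl.diffAt y)]
  have h2 : ∀ (i j : Fin 2), pd i (pd j fun z => exp (a * ℓ z)) x =
      exp (a * ℓ x) * a * (pd i (pd j ℓ) x + a * (pd i ℓ x * pd j ℓ x)) := by
    intro i j
    have hj := (contDiff_pd j sl).diffAt x
    rw [show (pd j fun z => exp (a * ℓ z)) = fun y => exp (a * ℓ y) * (a * pd j ℓ y) from
      funext (h1 j), pd_mul i (hal x).exp (hj.const_mul a), h1, pd_const_mul i a hj]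
    ring
  have h3 := hpde x (Set.mem_univ x)
  rw [hw] at h3
  simp only [Fin.sum_univ_two, cof, Matrix.adjugate_fin_two, Matrix.transpose_apply, h2] at h3
  simp only [hess, Matrix.of_apply, Matrix.cons_val', Matrix.cons_val_zero, Matrix.cons_val_one,
    Matrix.cons_val_fin_one, Fin.isValue] at h3
  rw [pd_comm 1 0 hf, pd_comm 1 0 sl] at h3
  have hne : exp (a * ℓ x) * a ≠ 0 := mul_ne_zero (exp_pos _).ne' ha
  apply mul_left_cancel₀ hne
  unfold cofLap cofGradSq cofForm
  linear_combination h3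

include hf in
lemma isQuadratic_of_hess_const (h : ∀ i j k x, pd k (pd i (pd j f)) x = 0) : IsQuadratic f := by
  have hp : ∀ j x, pd j f x =
      pd 0 (pd j f) 0 * x 0 + pd 1 (pd j f) 0 * x 1 + pd j f 0 := by
    intro j x
    have sj := contDiff_pd j hf
    have hc : ∀ i x, pd i (pd j f) x = pd i (pd j f) 0 := fun i x =>
      eq_of_pd_eq_zero (contDiff_pd i sj) (fun x k => h i j k x) x 0
    have key := eq_of_pd_eq_zero
      (u := fun y => pd j f y - (pd 0 (pd j f) 0 * y 0 + pd 1 (pd j f) 0 * y 1))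
      (sj.sub ((contDiff_const.mul (contDiff_apply ℝ ℝ 0)).add
        (contDiff_const.mul (contDiff_apply ℝ ℝ 1)))) (fun y i => by
        have := sj.diffAt y
        rw [pd_sub i this (by fun_prop), pd_add i (by fun_prop) (by fun_prop),
          pd_const_mul i _ (by fun_prop), pd_const_mul i _ (by fun_prop), pd_coord, pd_coord,
          hc i y]
        fin_cases i <;> simp) x 0
    simp at key
    linarith
  refine ⟨!![pd 0 (pd 0 f) 0 / 2, pd 0 (pd 1 f) 0 / 2; pd 0 (pd 1 f) 0 / 2, pd 1 (pd 1 f) 0 / 2],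
    fun i => pd i f 0, f 0, fun x => ?_⟩
  have hsym : pd 1 (pd 0 f) = pd 0 (pd 1 f) := pd_comm 1 0 hf
  have key := eq_of_pd_eq_zero
    (u := fun y => f y - (pd 0 (pd 0 f) 0 / 2 * (y 0 * y 0) + pd 0 (pd 1 f) 0 * (y 0 * y 1)
      + pd 1 (pd 1 f) 0 / 2 * (y 1 * y 1) + pd 0 f 0 * y 0 + pd 1 f 0 * y 1))
    (by
      exact hf.sub (by fun_prop)) (fun y i => by
      have := hf.diffAt y
      have hx : ∀ j : Fin 2, DifferentiableAt ℝ (fun y : Fin 2 → ℝ => y j) y := fun j => by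
        fun_prop
      rw [pd_sub i this (by fun_prop), pd_add i (by fun_prop) (by fun_prop),
        pd_add i (by fun_prop) (by fun_prop), pd_add i (by fun_prop) (by fun_prop),
        pd_add i (by fun_prop) (by fun_prop), pd_const_mul i _ (by fun_prop),
        pd_const_mul i _ (by fun_prop), pd_const_mul i _ (by fun_prop),
        pd_const_mul i _ (by fun_prop), pd_const_mul i _ (by fun_prop),
        pd_mul i (hx 0) (hx 0), pd_mul i (hx 0) (hx 1), pd_mul i (hx 1) (hx 1), pd_coord,
        pd_coord, hp i y]
      fin_cases i <;> simp [hsym] <;> ring) x 0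
  simp at key
  simp [Fin.sum_univ_two]
  linarith

end Equations

/-- Theorem 1 (Li–Jia). If a smooth, strictly convex function on all of `ℝ²`
satisfies `∑ F^{ij} w_ij = 0` with `w = (det D²f)^a` and `a ≤ -3/4`, then `f` is a
quadratic polynomial. -/
theorem statement0 (a : ℝ) (ha : a ≤ -3/4) (f : (Fin 2 → ℝ) → ℝ)
    (hsmooth : ContDiff ℝ (⊤ : ℕ∞) f)
    (hconv : ∀ x, (hess f x).PosDef)
    (hpde : PDE1 f a Set.univ) :
    IsQuadratic f := by
  have hpos : ∀ i x, 0 < pd i (pd i f) x := fun i x => (hconv x).diag_pos (i := i)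
  have hD : ∀ x, 0 < hessDet f x := fun x => det_hess hsmooth x ▸ (hconv x).det_pos
  have hDs := contDiff_hessDet hsmooth
  have hlog : ∀ x i, pd i (hessDet f) x =
      1 * hessDet f x * pd i (fun y => log (hessDet f y)) x := by
    intro x i
    have := (hD x).ne'
    rw [pd_log i (hDs.diffAt x) this]
    field_simp
  have hD0 : ∀ i x, pd i (hessDet f) x = 0 := by
    intro i x
    rw [hlog x i, pd_eq_zero_of_cofLap_eq hsmooth hpos hD (hDs.log fun y => (hD y).ne')
      (by linarith) zero_le_one le_rfl
      (cofLap_log_hessDet hsmooth (by linarith) hD hpde) hlog x i, mul_zero]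
  have hdiag : ∀ i k x, pd k (pd i (pd i f)) x = 0 := by
    intro i k x
    have hg := contDiff_pd i (contDiff_pd i hsmooth)
    have h := pd_eq_zero_of_cofLap_eq hsmooth hpos hD (hg.log fun y => (hpos i y).ne')
      (by norm_num) le_rfl zero_le_one
      (cofLap_log hg (hpos i) (mul_cofLap_pd_pd hsmooth hD0 i))
      (fun x j => by rw [hD0 j x]; ring) x k
    rw [pd_log k (hg.diffAt x) (hpos i x).ne', div_eq_zero_iff] at h
    exact h.resolve_right (hpos i x).ne'
  have hmix : ∀ k x, pd k (pd 0 (pd 1 f)) x = 0 := by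
    intro k x
    fin_cases k
    · exact (congrFun (pd_one_hess hsmooth) x).symm.trans (hdiag 0 1 x)
    · exact (congrFun (pd_zero_hess hsmooth) x).symm.trans (hdiag 1 0 x)
  refine isQuadratic_of_hess_const hsmooth fun i j k x => ?_
  fin_cases i <;> fin_cases j
  · exact hdiag 0 k x
  · exact hmix k x
  · exact (congrFun (congrArg (pd k) (pd_comm 1 0 hsmooth)) x).trans (hmix k x)
  · exact hdiag 1 k x
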